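/- arXiv:math/0408119 — 2 statements merged into one kernel-verified Lean document; each statement's English description precedes it below -/
import Mathlib

section
/- (Theorem 4.1: absence of arbitrage for small horizon.) Suppose T < 1/C. Then there exists an integer N₀ such that for every N ≥ N₀, every n with 1 ≤ n ≤ ⌊NT⌋, and every sign sequence ε ∈ {−1,1}^{n−1}: d_n(ε) < (r − b)/N < u_n(ε). (By Dzhaparidze's criterion, this condition is equivalent to the ⌊NT⌋-period binary market 𝓜^{(N)} with interest rate r/N, drift b/N and returns X_n^{(N)} being arbitrage-free.) -/
open MeasureTheory ProbabilityTheory Filter Topology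

/-- The low return `d_n(ε)` of the binary market `𝓜^{(N)}`. -/
noncomputable def dret (σ : ℝ) (y : ℝ → ℝ → ℝ) (N n : ℕ) (ε : ℕ → ℝ) : ℝ :=
  σ / Real.sqrt N *
      ∑ i ∈ Finset.Icc 1 (n - 1),
        (y ((n : ℝ) / N) ((i : ℝ) / N) - y (((n : ℝ) - 1) / N) ((i : ℝ) / N)) * ε i
    - σ / Real.sqrt N

/-- The high return `u_n(ε) = d_n(ε) + 2σ/√N` of the binary market `𝓜^{(N)}`. -/
noncomputable def uret (σ : ℝ) (y : ℝ → ℝ → ℝ) (N n : ℕ) (ε : ℕ → ℝ) : ℝ :=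
  dret σ y N n ε + 2 * σ / Real.sqrt N

/-- Theorem 4.1: for `T < 1/C` the binary market `𝓜^{(N)}` is
    arbitrage-free for all large `N`, via Dzhaparidze's criterion
    `d_n < (r-b)/N < u_n`. -/
theorem no_arbitrage_small_horizon
    (T : ℝ) (hT : 0 < T) (σ : ℝ) (hσ : 0 < σ) (b r : ℝ)
    (l : ℝ → ℝ → ℝ)
    (hl_meas : Measurable (Function.uncurry l))
    (M : ℝ)
    (hl_bdd : ∀ t ∈ Set.Icc (0:ℝ) T, ∀ u ∈ Set.Icc (0:ℝ) T, |l t u| ≤ M)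
    (hl_zero : ∀ t ∈ Set.Icc (0:ℝ) T, ∀ u ∈ Set.Icc (0:ℝ) T, t < u → l t u = 0)
    (y : ℝ → ℝ → ℝ)
    (hy : ∀ t u, y t u = 1 - ∫ s in u..t, l s u)
    (C : ℝ) (hC : 0 < C)
    (hyLip : ∀ t₁ ∈ Set.Icc (0:ℝ) T, ∀ t₂ ∈ Set.Icc (0:ℝ) T, ∀ u ∈ Set.Icc (0:ℝ) T,
      |y t₁ u - y t₂ u| ≤ C * |t₁ - t₂|)
    (hTC : T < 1 / C) :
    ∃ N₀ : ℕ, ∀ N : ℕ, N₀ ≤ N →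
      ∀ n : ℕ, 1 ≤ n → n ≤ ⌊(N : ℝ) * T⌋₊ →
        ∀ ε : ℕ → ℝ, (∀ i ∈ Finset.Icc 1 (n - 1), ε i = 1 ∨ ε i = -1) →
          dret σ y N n ε < (r - b) / N ∧ (r - b) / N < uret σ y N n ε := by
  have hCT : 0 < 1 - C * T := by
    rw [lt_div_iff₀ hC] at hTC
    linarith
  have hD : 0 < σ * (1 - C * T) := mul_pos hσ hCT
  obtain ⟨N₀, hN₀⟩ := exists_nat_gt ((|r - b| / (σ * (1 - C * T))) ^ 2)
  refine ⟨N₀, fun N hN n hn1 hn2 ε hε => ?_⟩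
  have hNK : (|r - b| / (σ * (1 - C * T))) ^ 2 < (N : ℝ) :=
    lt_of_lt_of_le hN₀ (by exact_mod_cast hN)
  have hNpos : (0 : ℝ) < N := lt_of_le_of_lt (sq_nonneg _) hNK
  have hs : 0 < Real.sqrt N := Real.sqrt_pos.mpr hNpos
  have hK : |r - b| < Real.sqrt N * (σ * (1 - C * T)) := by
    rw [← div_lt_iff₀ hD]
    exact Real.lt_sqrt_of_sq_lt hNK
  have hss : Real.sqrt N * Real.sqrt N = N := Real.mul_self_sqrt hNpos.le
  have hnNT : (n : ℝ) ≤ N * T :=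
    le_trans (by exact_mod_cast hn2) (Nat.floor_le (by positivity))
  have hn1' : (1 : ℝ) ≤ n := by exact_mod_cast hn1
  have hmem : ∀ x : ℝ, 0 ≤ x → x ≤ n → x / N ∈ Set.Icc (0 : ℝ) T := by
    intro x h0 h1
    refine ⟨by positivity, ?_⟩
    rw [div_le_iff₀ hNpos]
    linarith
  set S := ∑ i ∈ Finset.Icc 1 (n - 1),
        (y ((n : ℝ) / N) ((i : ℝ) / N) - y (((n : ℝ) - 1) / N) ((i : ℝ) / N)) * ε i with hS
  have hSb : |S| ≤ C * T := by
    have h1 : |S| ≤ ∑ i ∈ Finset.Icc 1 (n - 1), C * (1 / N) := by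
      refine (Finset.abs_sum_le_sum_abs _ _).trans (Finset.sum_le_sum fun i hi => ?_)
      have he : |ε i| = 1 := by
        rcases hε i hi with h | h <;> simp [h]
      have hin : (i : ℝ) ≤ n := by
        have := (Finset.mem_Icc.mp hi).2
        exact_mod_cast this.trans (Nat.sub_le n 1)
      rw [abs_mul, he, mul_one]
      have h2 := hyLip _ (hmem n (by linarith) le_rfl) _
        (hmem ((n : ℝ) - 1) (by linarith) (by linarith)) _ (hmem i (by positivity) hin)
      have h3 : (n : ℝ) / N - ((n : ℝ) - 1) / N = 1 / N := by ring
      rwa [h3, abs_of_pos (by positivity : (0 : ℝ) < 1 / N)] at h2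
    rw [Finset.sum_const, Nat.card_Icc, nsmul_eq_mul] at h1
    have h4 : ((n - 1 + 1 - 1 : ℕ) : ℝ) ≤ N * T :=
      le_trans (by exact_mod_cast (by omega : n - 1 + 1 - 1 ≤ n)) hnNT
    calc |S| ≤ _ := h1
      _ ≤ (N * T) * (C * (1 / N)) := by gcongr
      _ = C * T := by field_simp
  have hq : |(r - b) / N| < σ / Real.sqrt N * (1 - C * T) := by
    rw [abs_div, abs_of_pos hNpos, div_lt_iff₀ hNpos]
    calc |r - b| < _ := hK
      _ = σ / Real.sqrt N * (1 - C * T) * (Real.sqrt N * Real.sqrt N) := by field_simp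
      _ = _ := by rw [hss]
  have ha : 0 < σ / Real.sqrt N := by positivity
  have e1 := mul_le_mul_of_nonneg_left (abs_le.mp hSb).1 ha.le
  have e2 := mul_le_mul_of_nonneg_left (abs_le.mp hSb).2 ha.le
  have e3 := abs_lt.mp hq
  have e4 : 2 * σ / Real.sqrt N = 2 * (σ / Real.sqrt N) := by ring
  unfold uret dret
  rw [← hS, e4]
  constructor
  · linarith [e3.1]
  · linarith [e3.2]
end

section
/- (Existence of arbitrage for large horizon, Section 4.) Suppose in addition that there is a constant c > 0 with l(s,u) ≥ c for all 0 ≤ u < s ≤ T, that T > 1/c, and that r ≤ b. Then d_{⌊NT⌋}(−1,…,−1) = (σ/√N) Σ_{i=1}^{⌊NT⌋−1} ∫_{(⌊NT⌋−1)/N}^{⌊NT⌋/N} l(s, i/N) ds − σ/√N ≥ (σ/√N)( c(⌊NT⌋−1)/N − 1 ), and there exists an integer N₀ such that for all N ≥ N₀: d_{⌊NT⌋}(−1,…,−1) > (r − b)/N. (Hence the no-arbitrage condition d_n < (r−b)/N < u_n fails at n = ⌊NT⌋ on the event {ξ₁ = ⋯ = ξ_{⌊NT⌋−1} = −1}, so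 the binary market admits an arbitrage opportunity.) -/
open MeasureTheory ProbabilityTheory Filter Topology

/-- existence of arbitrage for large horizon (Section 4). -/
theorem arbitrage_large_horizon
    (T : ℝ) (hT : 0 < T) (σ : ℝ) (hσ : 0 < σ) (b r : ℝ)
    (l : ℝ → ℝ → ℝ)
    (hl_meas : Measurable (Function.uncurry l))
    (M : ℝ)
    (hl_bdd : ∀ t ∈ Set.Icc (0:ℝ) T, ∀ u ∈ Set.Icc (0:ℝ) T, |l t u| ≤ M)
    (hl_zero : ∀ t ∈ Set.Icc (0:ℝ) T, ∀ u ∈ Set.Icc (0:ℝ) T, t < u → l t u = 0)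
    (y : ℝ → ℝ → ℝ)
    (hy : ∀ t u, y t u = 1 - ∫ s in u..t, l s u)
    (C : ℝ) (hC : 0 < C)
    (hyLip : ∀ t₁ ∈ Set.Icc (0:ℝ) T, ∀ t₂ ∈ Set.Icc (0:ℝ) T, ∀ u ∈ Set.Icc (0:ℝ) T,
      |y t₁ u - y t₂ u| ≤ C * |t₁ - t₂|)
    (c : ℝ) (hc : 0 < c)
    (hlc : ∀ u s : ℝ, 0 ≤ u → u < s → s ≤ T → c ≤ l s u)
    (hTc : 1 / c < T) (hrb : r ≤ b) :
    (∀ N : ℕ, 1 ≤ N → 1 ≤ ⌊(N : ℝ) * T⌋₊ →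
      dret σ y N ⌊(N : ℝ) * T⌋₊ (fun _ => -1)
          = σ / Real.sqrt N *
              ∑ i ∈ Finset.Icc 1 (⌊(N : ℝ) * T⌋₊ - 1),
                (∫ s in (((⌊(N : ℝ) * T⌋₊ : ℝ) - 1) / N)..((⌊(N : ℝ) * T⌋₊ : ℝ) / N),
                  l s ((i : ℝ) / N))
            - σ / Real.sqrt N ∧
      σ / Real.sqrt N * (c * ((⌊(N : ℝ) * T⌋₊ : ℝ) - 1) / N - 1)
        ≤ dret σ y N ⌊(N : ℝ) * T⌋₊ (fun _ => -1)) ∧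
    ∃ N₀ : ℕ, ∀ N : ℕ, N₀ ≤ N →
      (r - b) / N < dret σ y N ⌊(N : ℝ) * T⌋₊ (fun _ => -1) := by
  have hint : ∀ u ∈ Set.Icc (0:ℝ) T, ∀ a₁ ∈ Set.Icc (0:ℝ) T, ∀ a₂ ∈ Set.Icc (0:ℝ) T,
      IntervalIntegrable (fun s => l s u) volume a₁ a₂ := by
    intro u hu a₁ h₁ a₂ h₂
    have hm : Measurable (fun s => l s u) :=
      hl_meas.comp (measurable_id.prodMk measurable_const)
    have hI : IntegrableOn (fun s => l s u) (Set.Icc 0 T) volume := by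
      refine Measure.integrableOn_of_bounded (M := M) ?_ hm.aestronglyMeasurable ?_
      · simp
      · filter_upwards [ae_restrict_mem measurableSet_Icc] with s hs
        exact hl_bdd s hs u hu
    have hsub : Set.uIcc a₁ a₂ ⊆ Set.Icc 0 T := Set.uIcc_subset_Icc h₁ h₂
    exact (hI.mono_set hsub).intervalIntegrable
  have key : ∀ N : ℕ, 1 ≤ N → 1 ≤ ⌊(N : ℝ) * T⌋₊ →
      dret σ y N ⌊(N : ℝ) * T⌋₊ (fun _ => -1)
          = σ / Real.sqrt N *
              ∑ i ∈ Finset.Icc 1 (⌊(N : ℝ) * T⌋₊ - 1),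
                (∫ s in (((⌊(N : ℝ) * T⌋₊ : ℝ) - 1) / N)..((⌊(N : ℝ) * T⌋₊ : ℝ) / N),
                  l s ((i : ℝ) / N))
            - σ / Real.sqrt N ∧
      σ / Real.sqrt N * (c * ((⌊(N : ℝ) * T⌋₊ : ℝ) - 1) / N - 1)
        ≤ dret σ y N ⌊(N : ℝ) * T⌋₊ (fun _ => -1) := by
    intro N hN hn
    have hN0 : (0:ℝ) < N := by exact_mod_cast hN
    have hfl : ((⌊(N : ℝ) * T⌋₊ : ℕ) : ℝ) ≤ N * T := Nat.floor_le (by positivity)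
    generalize ⌊(N : ℝ) * T⌋₊ = n at hn hfl ⊢
    have hn1 : (1:ℝ) ≤ n := by exact_mod_cast hn
    have hnT : (n:ℝ) / N ≤ T := by rw [div_le_iff₀ hN0]; linarith
    have hlt : ((n:ℝ) - 1) / N ≤ n / N := by gcongr; linarith
    have hb0 : 0 ≤ ((n:ℝ) - 1) / N := div_nonneg (by linarith) hN0.le
    have hbm : ((n:ℝ) - 1) / N ∈ Set.Icc (0:ℝ) T := ⟨hb0, hlt.trans hnT⟩
    have ham : (n:ℝ) / N ∈ Set.Icc (0:ℝ) T := ⟨hb0.trans hlt, hnT⟩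
    have hi : ∀ i ∈ Finset.Icc 1 (n - 1), (i:ℝ) / N ≤ ((n:ℝ) - 1) / N := by
      intro i hi
      have h2 : i + 1 ≤ n := by have := (Finset.mem_Icc.1 hi).2; omega
      have h3 : (i:ℝ) + 1 ≤ n := by exact_mod_cast h2
      gcongr
      linarith
    have him : ∀ i ∈ Finset.Icc 1 (n - 1), (i:ℝ) / N ∈ Set.Icc (0:ℝ) T := fun i h =>
      ⟨by positivity, (hi i h).trans hbm.2⟩
    have heq : dret σ y N n (fun _ => -1)
          = σ / Real.sqrt N *
              ∑ i ∈ Finset.Icc 1 (n - 1),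
                (∫ s in (((n : ℝ) - 1) / N)..((n : ℝ) / N), l s ((i : ℝ) / N))
            - σ / Real.sqrt N := by
      unfold dret
      congr 2
      refine Finset.sum_congr rfl fun i h => ?_
      have hu := him i h
      have := intervalIntegral.integral_add_adjacent_intervals
        (hint _ hu _ hu _ hbm) (hint _ hu _ hbm _ ham)
      rw [hy, hy, ← this]
      ring
    refine ⟨heq, ?_⟩
    have hsum : c * ((n:ℝ) - 1) / N ≤ ∑ i ∈ Finset.Icc 1 (n - 1),
        (∫ s in (((n : ℝ) - 1) / N)..((n : ℝ) / N), l s ((i : ℝ) / N)) := by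
      have h1 : ∀ i ∈ Finset.Icc 1 (n - 1), c / N ≤
          ∫ s in (((n : ℝ) - 1) / N)..((n : ℝ) / N), l s ((i : ℝ) / N) := by
        intro i h
        have h2 : ∫ s in (((n : ℝ) - 1) / N)..((n : ℝ) / N), c ≤
            ∫ s in (((n : ℝ) - 1) / N)..((n : ℝ) / N), l s ((i : ℝ) / N) := by
          refine intervalIntegral.integral_mono_on_of_le_Ioo hlt (by simp)
            (hint _ (him i h) _ hbm _ ham) ?_
          intro s hs
          exact hlc _ _ (him i h).1 ((hi i h).trans_lt hs.1) (hs.2.le.trans hnT)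
        rw [intervalIntegral.integral_const, smul_eq_mul] at h2
        refine le_trans (le_of_eq ?_) h2
        field_simp
        ring
      have h3 := Finset.card_nsmul_le_sum _ _ _ h1
      rw [Nat.card_Icc, nsmul_eq_mul, Nat.add_sub_cancel, Nat.cast_sub hn, Nat.cast_one] at h3
      refine le_trans (le_of_eq ?_) h3
      ring
    rw [heq]
    have hs : 0 ≤ σ / Real.sqrt N := by positivity
    have := mul_le_mul_of_nonneg_left hsum hs
    linarith
  refine ⟨key, ?_⟩
  have hcT : 0 < c * T - 1 := by
    rw [div_lt_iff₀ hc] at hTc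
    linarith
  obtain ⟨K, hK⟩ := exists_nat_gt (max (2 * c / (c * T - 1)) (1 / T))
  refine ⟨K + 1, fun N hN => ?_⟩
  have hN1 : 1 ≤ N := by omega
  have hN0 : (0:ℝ) < N := by exact_mod_cast hN1
  have hKN : (K:ℝ) ≤ N := by exact_mod_cast (by omega : K ≤ N)
  have hA : 2 * c / (c * T - 1) < N := ((le_max_left _ _).trans_lt hK).trans_le hKN
  have hB : 1 / T < N := ((le_max_right _ _).trans_lt hK).trans_le hKN
  rw [div_lt_iff₀ hcT] at hA
  rw [div_lt_iff₀ hT] at hB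
  have hn : 1 ≤ ⌊(N : ℝ) * T⌋₊ := Nat.le_floor (by push_cast; exact hB.le)
  refine lt_of_lt_of_le ?_ (key N hN1 hn).2
  have hf := Nat.lt_floor_add_one ((N:ℝ) * T)
  have h1 : (r - b) / N ≤ 0 := div_nonpos_of_nonpos_of_nonneg (by linarith) hN0.le
  have h2 : 1 < c * ((⌊(N : ℝ) * T⌋₊ : ℝ) - 1) / N := by
    rw [lt_div_iff₀ hN0]
    have := mul_lt_mul_of_pos_left hf hc
    linarith
  have h3 : 0 < σ / Real.sqrt N := by positivity
  have := mul_pos h3 (sub_pos.2 h2)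
  linarith
end
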